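/- A translation T_α of the torus T^d has the monotone shrinking target property if and only if α is a constant type vector. -/

import Mathlib

open MeasureTheory Filter Metric ENNReal Topology


/-- `‖v‖_ℤ`: the maximum over coordinates of the distance of `v i` to the nearest integer,
realized as the sup-distance to `0` in the torus `ℝ^d/ℤ^d`. -/
noncomputable def normZ {d : ℕ} (v : Fin d → ℝ) : ℝ :=
  dist (fun i => ((v i : ℝ) : AddCircle (1:ℝ))) (0 : Fin d → AddCircle (1:ℝ))

abbrev MTor (d : ℕ) : Type := Fin d → AddCircle (1:ℝ)

lemma mtor_circle_ball (x : AddCircle (1:ℝ)) (r : ℝ) :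
    volume (ball x r) = ENNReal.ofReal (min 1 (2 * r)) := by
  rw [← AddCircle.volume_closedBall (1:ℝ) (x := x)]
  exact (measure_congr AddCircle.closedBall_ae_eq_ball).symm

lemma mtor_univ (d : ℕ) : volume (Set.univ : Set (MTor d)) = 1 := by
  rw [MeasureTheory.volume_pi, MeasureTheory.Measure.pi_univ]
  simp

instance mtor_prob (d : ℕ) : IsProbabilityMeasure (volume : Measure (MTor d)) := ⟨mtor_univ d⟩

lemma mtor_ball {d : ℕ} (hd : 0 < d) (x : MTor d) {r : ℝ} (h0 : 0 ≤ r) (h1 : r ≤ 1/2) :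
    volume (ball x r) = ENNReal.ofReal ((2 * r) ^ d) := by
  rcases h0.eq_or_lt with rfl | h0
  · simp [hd.ne']
  · rw [volume_pi_ball x h0]
    simp only [mtor_circle_ball]
    rw [min_eq_right (by linarith), Finset.prod_const, ← ENNReal.ofReal_pow (by linarith)]
    simp

lemma mtor_ball_le {d : ℕ} (hd : 0 < d) (x : MTor d) {r : ℝ} (h0 : 0 ≤ r) :
    volume (ball x r) ≤ ENNReal.ofReal ((2 * r) ^ d) := by
  rcases h0.eq_or_lt with rfl | h0
  · simp
  · rw [volume_pi_ball x h0]
    simp only [mtor_circle_ball]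
    rw [Finset.prod_const, ← ENNReal.ofReal_pow (by positivity)]
    simp only [Finset.card_univ, Fintype.card_fin]
    apply ENNReal.ofReal_le_ofReal
    gcongr
    exact min_le_right _ _

lemma mtor_pow_rpow {d : ℕ} (hd : 0 < d) {x : ℝ} (hx : 0 ≤ x) :
    (x ^ (-(1:ℝ)/(d:ℝ))) ^ d = x⁻¹ := by
  rw [← Real.rpow_natCast, ← Real.rpow_mul hx]
  have : (d:ℝ) ≠ 0 := by positivity
  rw [div_mul_cancel₀ _ this, Real.rpow_neg_one]

lemma mtor_approx {d : ℕ} (a : MTor d)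
    (h : ∀ C : ℝ, 0 < C → ∃ Q : ℤ, Q ≠ 0 ∧ ‖Q • a‖ < C * |(Q:ℝ)| ^ (-(1:ℝ)/(d:ℝ)))
    (A M : ℕ) (hA : 0 < A) :
    ∃ Q : ℕ, M ≤ Q ∧ 0 < Q ∧ ‖Q • a‖ * A ≤ 1/2 * ((A * Q : ℕ):ℝ) ^ (-(1:ℝ)/(d:ℝ)) := by
  set p : ℝ := -(1:ℝ)/(d:ℝ) with hp
  have hA' : (0:ℝ) < A := by exact_mod_cast hA
  have hm : (0:ℝ) < ((M+1 : ℕ):ℝ) := by positivity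
  obtain ⟨Q, hQ, hlt⟩ := h (1/2 * (A:ℝ)^p / A * (((M+1:ℕ):ℝ)^p / ((M+1:ℕ):ℝ))) (by positivity)
  have hQ1 : 0 < Q.natAbs := Int.natAbs_pos.mpr hQ
  have hQ2 : ‖Q • a‖ = ‖Q.natAbs • a‖ := by
    rcases Int.natAbs_eq Q with h | h
    · rw [h]; simp
    · rw [h]; simp
  have hQ3 : |(Q:ℝ)| = (Q.natAbs : ℝ) := by
    rw [Nat.cast_natAbs]; simp
  rw [hQ2, hQ3] at hlt
  generalize Q.natAbs = q at hlt hQ1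
  refine ⟨(M+1) * q, by nlinarith, by positivity, ?_⟩
  have h1 : ‖((M+1)*q) • a‖ ≤ ((M+1:ℕ):ℝ) * ‖q • a‖ := by
    rw [mul_smul]; exact norm_nsmul_le
  have e : ((A * ((M+1)*q) : ℕ):ℝ)^p = (A:ℝ)^p * (((M+1:ℕ):ℝ)^p * (q:ℝ)^p) := by
    rw [Nat.cast_mul, Nat.cast_mul, Real.mul_rpow (by positivity) (by positivity),
      Real.mul_rpow (by positivity) (by positivity)]
  rw [e]
  calc ‖((M+1)*q) • a‖ * A ≤ ((M+1:ℕ):ℝ) * ‖q • a‖ * A := by gcongr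
    _ ≤ ((M+1:ℕ):ℝ) * (1/2 * (A:ℝ)^p / A * (((M+1:ℕ):ℝ)^p / ((M+1:ℕ):ℝ)) * (q:ℝ)^p) * A := by gcongr
    _ = _ := by field_simp

lemma mtor_window {d : ℕ} (hd : 0 < d) (a : MTor d) (A Q : ℕ) (hQ : 0 < Q) (ρ : ℝ)
    (hρ : 0 ≤ ρ) (h : ‖Q • a‖ * A ≤ ρ) :
    volume {x : MTor d | ∃ n < A * Q, x + n • a ∈ ball (0 : MTor d) ρ} ≤
      ENNReal.ofReal (Q * (4 * ρ) ^ d) := by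
  have hsub : {x : MTor d | ∃ n < A * Q, x + n • a ∈ ball (0 : MTor d) ρ} ⊆
      ⋃ b ∈ Finset.range Q, ball (-(b • a)) (2 * ρ) := by
    rintro x ⟨n, hn, hx⟩
    simp only [Set.mem_iUnion, Finset.mem_range]
    refine ⟨n % Q, Nat.mod_lt _ hQ, ?_⟩
    rw [mem_ball_zero_iff] at hx
    rw [mem_ball, dist_eq_norm, sub_neg_eq_add]
    have e : n • a = (n / Q) • (Q • a) + (n % Q) • a := by
      rw [smul_smul, ← add_smul, mul_comm, Nat.div_add_mod]
    have e2 : x + (n % Q) • a = (x + n • a) - (n / Q) • (Q • a) := by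
      rw [e]; abel
    rw [e2]
    have h2 : ‖(n / Q) • (Q • a)‖ ≤ ρ := by
      have hdiv : n / Q ≤ A := (Nat.div_lt_of_lt_mul (by rwa [mul_comm])).le
      calc ‖(n / Q) • (Q • a)‖ ≤ ((n / Q : ℕ):ℝ) * ‖Q • a‖ := norm_nsmul_le
        _ ≤ A * ‖Q • a‖ := by gcongr
        _ ≤ ρ := by linarith
    have := norm_sub_le (x + n • a) ((n / Q) • (Q • a))
    linarith
  refine (measure_mono hsub).trans ((measure_biUnion_finset_le _ _).trans ?_)
  refine (Finset.sum_le_sum (fun b _ => mtor_ball_le hd _ (by positivity : 0 ≤ 2 * ρ))).trans ?_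
  rw [Finset.sum_const, Finset.card_range, nsmul_eq_mul, ENNReal.ofReal_mul (by positivity),
    ENNReal.ofReal_natCast, ← mul_assoc]
  norm_num

lemma mtor_seq {d : ℕ} (a : MTor d)
    (h : ∀ C : ℝ, 0 < C → ∃ Q : ℤ, Q ≠ 0 ∧ ‖Q • a‖ < C * |(Q:ℝ)| ^ (-(1:ℝ)/(d:ℝ)))
    (A : ℕ → ℕ) (hA : ∀ k, 0 < A k) :
    ∃ N : ℕ → ℕ, (∀ k, ∃ Q : ℕ, 0 < Q ∧ N k = A k * Q ∧
      ‖Q • a‖ * A k ≤ 1/2 * (N k : ℝ) ^ (-(1:ℝ)/(d:ℝ))) ∧ ∀ k, 2 * N k ≤ N (k+1) := by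
  choose f hf1 hf2 hf3 using fun k M => mtor_approx a h (A k) M (hA k)
  let N : ℕ → ℕ := fun k => Nat.rec (A 0 * f 0 1) (fun k Nk => A (k+1) * f (k+1) (2 * Nk)) k
  refine ⟨N, ?_, ?_⟩
  · rintro (_ | k)
    · exact ⟨f 0 1, hf2 _ _, rfl, hf3 _ _⟩
    · exact ⟨f (k+1) (2 * N k), hf2 _ _, rfl, hf3 _ _⟩
  · intro k
    show 2 * N k ≤ A (k+1) * f (k+1) (2 * N k)
    have := hf1 (k+1) (2 * N k)
    have := hA (k+1)
    nlinarith

lemma mtor_forward {d : ℕ} (hd : 0 < d) (a : MTor d)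
    (h : ∀ C : ℝ, 0 < C → ∃ Q : ℤ, Q ≠ 0 ∧ ‖Q • a‖ < C * |(Q:ℝ)| ^ (-(1:ℝ)/(d:ℝ))) :
    ∃ r : ℕ → ℝ, Antitone r ∧ (∀ n, 0 ≤ r n) ∧ (∑' n, volume (ball (0 : MTor d) (r n)) = ⊤) ∧
      volume {x : MTor d | ∃ᶠ n in atTop, x + n • a ∈ ball (0 : MTor d) (r n)} < 1 := by
  obtain ⟨N, hN, hN2⟩ := mtor_seq a h (fun k => 2 ^ d * 2 ^ (k+2)) (fun k => by positivity)
  set p : ℝ := -(1:ℝ)/(d:ℝ) with hp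
  have hp0 : p ≤ 0 := by
    rw [hp]; apply div_nonpos_of_nonpos_of_nonneg <;> [norm_num; positivity]
  have hNpos : ∀ k, 0 < N k := by
    intro k
    obtain ⟨Q, hQ, e, -⟩ := hN k
    rw [e]; positivity
  have hmono : StrictMono N := strictMono_nat_of_lt_succ (fun k => by
    have := hNpos k; have := hN2 k; omega)
  have hex : ∀ n, ∃ k, n < N k := fun n => ⟨n+1, (Nat.lt_succ_self n).trans_le (hmono.id_le _)⟩
  let κ : ℕ → ℕ := fun n => Nat.find (hex n)
  have hκ : ∀ n, n < N (κ n) := fun n => Nat.find_spec (hex n)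
  have hκle : ∀ n k, n < N k → κ n ≤ k := fun n k h => Nat.find_min' (hex n) h
  let ρ : ℕ → ℝ := fun k => 1/2 * (N k : ℝ) ^ p
  have hρpos : ∀ k, 0 < ρ k := fun k => by
    have : (0:ℝ) < N k := by exact_mod_cast hNpos k
    positivity
  have hρanti : Antitone ρ := by
    intro j k hjk
    have h1 : (0:ℝ) < N j := by exact_mod_cast hNpos j
    have h2 : (N j : ℝ) ≤ N k := by exact_mod_cast hmono.monotone hjk
    have := Real.rpow_le_rpow_of_nonpos h1 h2 hp0
    show 1/2 * (N k : ℝ) ^ p ≤ 1/2 * (N j : ℝ) ^ p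
    linarith
  have hρhalf : ∀ k, ρ k ≤ 1/2 := by
    intro k
    have h1 : (1:ℝ) ≤ N k := by exact_mod_cast hNpos k
    have := Real.rpow_le_one_of_one_le_of_nonpos h1 hp0
    show 1/2 * (N k : ℝ) ^ p ≤ 1/2
    linarith
  have hρd : ∀ k, (2 * ρ k) ^ d = (N k : ℝ)⁻¹ := by
    intro k
    have : 2 * ρ k = (N k : ℝ) ^ p := by show 2 * (1/2 * (N k : ℝ) ^ p) = _; ring
    rw [this, hp, mtor_pow_rpow hd (by positivity)]
  refine ⟨fun n => ρ (κ n), ?_, fun n => (hρpos _).le, ?_, ?_⟩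
  · intro m n hmn
    exact hρanti (hκle _ _ (hmn.trans_lt (hκ n)))
  · have key : ∀ k : ℕ, ENNReal.ofReal (k * (1/2)) ≤
        ∑ n ∈ Finset.range (N k), volume (ball (0 : MTor d) (ρ (κ n))) := by
      intro k
      induction k with
      | zero => simp
      | succ k ih =>
        rw [← Finset.sum_range_add_sum_Ico _ (hmono (Nat.lt_succ_self k)).le, Nat.cast_succ, add_mul,
          ENNReal.ofReal_add (by positivity) (by norm_num)]
        refine add_le_add ih ?_
        have h1 : ∀ n ∈ Finset.Ico (N k) (N (k+1)), ENNReal.ofReal ((N (k+1) : ℝ)⁻¹) ≤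
            volume (ball (0 : MTor d) (ρ (κ n))) := by
          intro n hn
          rw [← hρd, ← mtor_ball hd 0 (hρpos _).le (hρhalf _)]
          exact measure_mono (ball_subset_ball (hρanti (hκle _ _ (Finset.mem_Ico.mp hn).2)))
        refine le_trans ?_ (Finset.sum_le_sum h1)
        rw [Finset.sum_const, nsmul_eq_mul, Nat.card_Ico, ← ENNReal.ofReal_natCast,
          ← ENNReal.ofReal_mul (by positivity)]
        apply ENNReal.ofReal_le_ofReal
        rw [Nat.cast_sub (hmono (Nat.lt_succ_self k)).le]
        have h2 : (0:ℝ) < N (k+1) := by exact_mod_cast hNpos (k+1)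
        have h3 : 2 * (N k : ℝ) ≤ N (k+1) := by exact_mod_cast hN2 k
        rw [← div_eq_mul_inv, le_div_iff₀ h2]
        linarith
    refine ENNReal.eq_top_of_forall_nnreal_le ?_
    intro c
    obtain ⟨k, hk⟩ := exists_nat_ge (2 * (c:ℝ))
    refine le_trans ?_ ((key k).trans (ENNReal.sum_le_tsum _))
    rw [← ENNReal.ofReal_coe_nnreal]
    apply ENNReal.ofReal_le_ofReal
    linarith
  · have hsub : {x : MTor d | ∃ᶠ n in atTop, x + n • a ∈ ball (0 : MTor d) (ρ (κ n))} ⊆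
        ⋃ k, {x : MTor d | ∃ n < N k, x + n • a ∈ ball (0 : MTor d) (ρ k)} := by
      intro x hx
      obtain ⟨n, hn⟩ := (show ∃ᶠ n in atTop, x + n • a ∈ ball (0 : MTor d) (ρ (κ n)) from hx).exists
      exact Set.mem_iUnion.mpr ⟨κ n, n, hκ n, hn⟩
    have hk : ∀ k, volume {x : MTor d | ∃ n < N k, x + n • a ∈ ball (0 : MTor d) (ρ k)} ≤
        ENNReal.ofReal (1/2/2/2^k) := by
      intro k
      obtain ⟨Q, hQ, e, hle⟩ := hN k
      have := mtor_window hd a _ Q hQ (ρ k) (hρpos k).le hle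
      rw [← e] at this
      refine this.trans (ENNReal.ofReal_le_ofReal (le_of_eq ?_))
      have e4 : 4 * ρ k = 2 * (2 * ρ k) := by ring
      rw [e4, mul_pow, hρd, e]
      push_cast
      have : (0:ℝ) < Q := by exact_mod_cast hQ
      field_simp
      ring
    refine (measure_mono hsub).trans_lt ((measure_iUnion_le _).trans_lt ?_)
    refine (ENNReal.tsum_le_tsum hk).trans_lt ?_
    rw [← ENNReal.ofReal_tsum_of_nonneg (fun k => by positivity) (summable_geometric_two' _),
      tsum_geometric_two']
    rw [ENNReal.ofReal_lt_one]; norm_num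

lemma mtor_union {d : ℕ} (hd : 0 < d) (S : Finset ℕ) (c : ℕ → MTor d) (δ ρ : ℝ) (hδ1 : δ ≤ 1)
    (hsep : ∀ m ∈ S, ∀ n ∈ S, m ≠ n → δ ≤ dist (c m) (c n)) (h0 : 0 ≤ ρ) (hρ : ρ ≤ δ / 2) :
    volume.real (⋃ n ∈ S, ball (c n) ρ) = S.card * (2 * ρ) ^ d := by
  rw [measureReal_biUnion_finset]
  · rw [Finset.sum_congr rfl (g := fun _ => (2 * ρ) ^ d), Finset.sum_const, nsmul_eq_mul]
    intro n _
    rw [measureReal_def, mtor_ball hd _ h0 (by linarith), ENNReal.toReal_ofReal (by positivity)]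
  · intro m hm n hn hmn
    exact ball_disjoint_ball (by have := hsep m hm n hn hmn; linarith)
  · exact fun n _ => measurableSet_ball

lemma mtor_count {d : ℕ} (hd : 0 < d) (S : Finset ℕ) (c : ℕ → MTor d) (δ : ℝ) (hδ0 : 0 < δ)
    (hδ1 : δ ≤ 1)
    (hsep : ∀ m ∈ S, ∀ n ∈ S, m ≠ n → δ ≤ dist (c m) (c n)) (y : MTor d) (R : ℝ) (hR : 0 ≤ R) :
    ((S.filter (fun n => dist (c n) y < R)).card : ℝ) * δ ^ d ≤ (2 * R + δ) ^ d := by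
  have h1 := mtor_union hd (S.filter (fun n => dist (c n) y < R)) c δ (δ/2) hδ1
    (fun m hm n hn => hsep m (Finset.mem_filter.mp hm).1 n (Finset.mem_filter.mp hn).1)
    (by positivity) le_rfl
  rw [mul_div_cancel₀ δ two_ne_zero] at h1
  rw [← h1]
  have h2 : volume.real (ball y (R + δ/2)) ≤ (2 * R + δ) ^ d := by
    have := ENNReal.toReal_mono ENNReal.ofReal_ne_top
      (mtor_ball_le hd y (by positivity : 0 ≤ R + δ/2))
    rw [ENNReal.toReal_ofReal (by positivity)] at this
    rw [measureReal_def]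
    convert this using 2
    ring
  refine le_trans (measureReal_mono ?_) h2
  refine Set.iUnion₂_subset (fun n hn => ?_)
  apply ball_subset_ball'
  have := (Finset.mem_filter.mp hn).2
  linarith

lemma mtor_add_pow (x y : ℝ) (hx : 0 ≤ x) (hy : 0 ≤ y) (d : ℕ) :
    (x + y) ^ d ≤ 2 ^ d * (x ^ d + y ^ d) := by
  have hx' : 0 ≤ x ^ d := by positivity
  have hy' : 0 ≤ y ^ d := by positivity
  rcases le_total x y with h | h
  · calc (x + y) ^ d ≤ (2 * y) ^ d := by gcongr; linarith
      _ = 2 ^ d * y ^ d := mul_pow _ _ _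
      _ ≤ _ := by gcongr; linarith
  · calc (x + y) ^ d ≤ (2 * x) ^ d := by gcongr; linarith
      _ = 2 ^ d * x ^ d := mul_pow _ _ _
      _ ≤ _ := by gcongr; linarith

lemma mtor_inter {d : ℕ} (hd : 0 < d) (S S' : Finset ℕ) (c : ℕ → MTor d) (δ ρ ρ' : ℝ)
    (hδ0 : 0 < δ) (hδ1 : δ ≤ 1)
    (hsep : ∀ m ∈ S', ∀ n ∈ S', m ≠ n → δ ≤ dist (c m) (c n)) (h0 : 0 ≤ ρ)
    (h0' : 0 ≤ ρ') (hρ' : ρ' ≤ δ / 2) :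
    volume.real ((⋃ n ∈ S, ball (c n) ρ) ∩ (⋃ n ∈ S', ball (c n) ρ')) ≤
      S.card * (2 ^ d * ((2 * ρ) ^ d + (2 * δ) ^ d) / δ ^ d * (2 * ρ') ^ d) := by
  have hsub : (⋃ n ∈ S, ball (c n) ρ) ∩ (⋃ n ∈ S', ball (c n) ρ') ⊆
      ⋃ n ∈ S, ⋃ m ∈ S'.filter (fun m => dist (c m) (c n) < ρ + ρ'), ball (c m) ρ' := by
    rintro x ⟨h1, h2⟩
    simp only [Set.mem_iUnion, mem_ball] at h1 h2 ⊢
    obtain ⟨n, hn, hx⟩ := h1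
    obtain ⟨m, hm, hx'⟩ := h2
    refine ⟨n, hn, m, Finset.mem_filter.mpr ⟨hm, ?_⟩, hx'⟩
    have := dist_triangle_left (c m) (c n) x
    linarith
  refine (measureReal_mono hsub (measure_ne_top _ _)).trans ((measureReal_biUnion_finset_le _ _).trans ?_)
  rw [← nsmul_eq_mul]
  apply Finset.sum_le_card_nsmul
  intro n hn
  rw [mtor_union hd _ c δ ρ' hδ1 (fun m hm n hn =>
    hsep m (Finset.mem_filter.mp hm).1 n (Finset.mem_filter.mp hn).1) h0' hρ']
  gcongr
  rw [le_div_iff₀ (by positivity)]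
  refine (mtor_count hd S' c δ hδ0 hδ1 hsep (c n) (ρ + ρ') (by positivity)).trans ?_
  refine le_trans ?_ (mtor_add_pow (2 * ρ) (2 * δ) (by positivity) (by positivity) d)
  exact pow_le_pow_left₀ (by positivity) (by linarith) d

lemma kochen_stone {Ω : Type*} [MeasurableSpace Ω] (μ : Measure Ω) [IsProbabilityMeasure μ]
    (F : ℕ → Set Ω) (hF : ∀ k, MeasurableSet (F k)) (K : ℝ) (hK : 0 < K)
    (hq : ∀ j k, j ≤ k → μ.real (F j ∩ F k) ≤
      K * (μ.real (F j) * μ.real (F k) + 2 ^ j / 2 ^ k * μ.real (F k)))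
    (hs : ¬ Summable (fun k => μ.real (F k))) :
    0 < μ {x | ∃ᶠ k in atTop, x ∈ F k} := by
  let G : ℕ → Set Ω := fun M => ⋃ k ≥ M, F k
  have hGm : ∀ M, MeasurableSet (G M) := fun M =>
    MeasurableSet.iUnion fun k => MeasurableSet.iUnion fun _ => hF k
  have hG : ∀ M, 1 / (2 * K) ≤ μ.real (G M) := by
    intro M
    have hlarge : ∃ N, 4 ≤ ∑ k ∈ Finset.Ico M N, μ.real (F k) := by
      have h1 := (not_summable_iff_tendsto_nat_atTop_of_nonneg
        (fun k => measureReal_nonneg)).mp hs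
      obtain ⟨N, hN, hMN⟩ := ((h1.eventually_ge_atTop
        (4 + ∑ k ∈ Finset.range M, μ.real (F k))).and (eventually_ge_atTop M)).exists
      refine ⟨N, ?_⟩
      rw [← Finset.sum_range_add_sum_Ico _ hMN] at hN
      linarith
    obtain ⟨N, hN⟩ := hlarge
    set I := Finset.Ico M N with hI
    set S := ∑ k ∈ I, μ.real (F k) with hS
    let w : ℕ → ℕ → ℝ := fun j k => if j ≤ k then 2 ^ j / 2 ^ k else 0
    have hw0 : ∀ j k, 0 ≤ w j k := by
      intro j k; simp only [w]; split_ifs <;> positivity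
    have hw : ∀ k, ∑ j ∈ I, w j k ≤ 2 := by
      intro k
      have h1 : ∑ j ∈ I, w j k ≤ ∑ j ∈ Finset.range (k+1), (2:ℝ) ^ j / 2 ^ k := by
        simp only [w]
        rw [← Finset.sum_filter]
        apply Finset.sum_le_sum_of_subset_of_nonneg
        · intro j hj
          rw [Finset.mem_filter] at hj
          exact Finset.mem_range.mpr (by omega)
        · intros; positivity
      refine h1.trans ?_
      rw [← Finset.sum_div, geom_sum_eq (by norm_num), div_le_iff₀ (by positivity), pow_succ]
      have : (0:ℝ) < 2 ^ k := by positivity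
      linarith
    have hpair : ∀ j k, μ.real (F j ∩ F k) ≤
        K * (μ.real (F j) * μ.real (F k) + w j k * μ.real (F k) + w k j * μ.real (F j)) := by
      intro j k
      rcases le_total j k with h | h
      · refine (hq j k h).trans ?_
        refine mul_le_mul_of_nonneg_left ?_ hK.le
        have : w j k = 2 ^ j / 2 ^ k := by simp [w, h]
        rw [this]
        have := mul_nonneg (hw0 k j) (measureReal_nonneg (μ := μ) (s := F j))
        linarith
      · rw [Set.inter_comm]
        refine (hq k j h).trans ?_
        refine mul_le_mul_of_nonneg_left ?_ hK.le
        have : w k j = 2 ^ k / 2 ^ j := by simp [w, h]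
        rw [this]
        have := mul_nonneg (hw0 j k) (measureReal_nonneg (μ := μ) (s := F k))
        linarith
    have hsum2 : ∑ j ∈ I, ∑ k ∈ I, μ.real (F j ∩ F k) ≤ K * (S * S + 4 * S) := by
      have e1 : ∑ j ∈ I, ∑ k ∈ I, w j k * μ.real (F k) ≤ 2 * S := by
        rw [Finset.sum_comm, hS, Finset.mul_sum]
        apply Finset.sum_le_sum
        intro k _
        rw [← Finset.sum_mul]
        exact mul_le_mul_of_nonneg_right (hw k) measureReal_nonneg
      have e2 : ∑ j ∈ I, ∑ k ∈ I, w k j * μ.real (F j) ≤ 2 * S := by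
        rw [Finset.sum_comm]; exact e1
      calc ∑ j ∈ I, ∑ k ∈ I, μ.real (F j ∩ F k)
          ≤ ∑ j ∈ I, ∑ k ∈ I, K * (μ.real (F j) * μ.real (F k) + w j k * μ.real (F k)
              + w k j * μ.real (F j)) :=
            Finset.sum_le_sum fun j _ => Finset.sum_le_sum fun k _ => hpair j k
        _ = K * (S * S + ∑ j ∈ I, ∑ k ∈ I, w j k * μ.real (F k)
              + ∑ j ∈ I, ∑ k ∈ I, w k j * μ.real (F j)) := by
            simp only [← Finset.mul_sum, Finset.sum_add_distrib]
            rw [hS, Finset.sum_mul]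
        _ ≤ K * (S * S + 4 * S) := by
            exact mul_le_mul_of_nonneg_left (by linarith) hK.le
    -- second moment
    let u : ℕ → Ω → ℝ := fun k => (F k).indicator 1
    have hIntegr : ∀ s : Set Ω, MeasurableSet s → Integrable (s.indicator (1 : Ω → ℝ)) μ := by
      intro s hs
      exact (integrable_const (1:ℝ)).indicator hs
    have hu : ∀ j k, (fun x => u j x * u k x) = (F j ∩ F k).indicator (1 : Ω → ℝ) := by
      intro j k
      rw [Set.inter_indicator_one]; rfl
    set l : ℝ := 1 / (2 * K * S) with hl
    have hSpos : 0 < S := by linarith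
    have hlpos : 0 < l := by positivity
    have hpt : ∀ x, ∑ k ∈ I, u k x ≤ l / 2 * (∑ j ∈ I, ∑ k ∈ I, u j x * u k x)
        + 1 / (2 * l) * (G M).indicator (1 : Ω → ℝ) x := by
      intro x
      rw [← Finset.sum_mul_sum]
      by_cases hx : x ∈ G M
      · rw [Set.indicator_of_mem hx, Pi.one_apply]
        generalize ∑ k ∈ I, u k x = f
        have h3 : l / 2 * (f * f) + 1 / (2 * l) * 1 - f = (l * f - 1) ^ 2 / (2 * l) := by
          field_simp; ring
        have : 0 ≤ (l * f - 1) ^ 2 / (2 * l) := by positivity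
        linarith
      · have h0 : ∑ k ∈ I, u k x = 0 := by
          apply Finset.sum_eq_zero
          intro k hk
          apply Set.indicator_of_notMem
          intro hxk
          exact hx (Set.mem_iUnion₂.mpr ⟨k, (Finset.mem_Ico.mp hk).1, hxk⟩)
        rw [h0, Set.indicator_of_notMem hx]; simp
    have hi1 : Integrable (fun x => ∑ k ∈ I, u k x) μ :=
      integrable_finsetSum _ fun k _ => hIntegr _ (hF k)
    have hi2 : Integrable (fun x => ∑ j ∈ I, ∑ k ∈ I, u j x * u k x) μ :=
      integrable_finsetSum _ fun j _ => integrable_finsetSum _ fun k _ => by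
        rw [hu]; exact hIntegr _ ((hF j).inter (hF k))
    have hle := integral_mono hi1 ((hi2.const_mul (l/2)).add ((hIntegr _ (hGm M)).const_mul (1/(2*l)))) hpt
    have v1 : ∫ x, ∑ k ∈ I, u k x ∂μ = S := by
      rw [integral_finsetSum _ fun k _ => hIntegr _ (hF k)]
      exact Finset.sum_congr rfl fun k _ => integral_indicator_one (hF k)
    have v2 : ∫ x, ∑ j ∈ I, ∑ k ∈ I, u j x * u k x ∂μ
        = ∑ j ∈ I, ∑ k ∈ I, μ.real (F j ∩ F k) := by
      rw [integral_finsetSum _ fun j _ => integrable_finsetSum _ fun k _ => by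
        rw [hu]; exact hIntegr _ ((hF j).inter (hF k))]
      refine Finset.sum_congr rfl fun j _ => ?_
      rw [integral_finsetSum _ fun k _ => by
        rw [hu]; exact hIntegr _ ((hF j).inter (hF k))]
      refine Finset.sum_congr rfl fun k _ => ?_
      rw [hu, integral_indicator_one ((hF j).inter (hF k))]
    have v3 : ∫ x, (l / 2 * (∑ j ∈ I, ∑ k ∈ I, u j x * u k x)
        + 1 / (2 * l) * (G M).indicator (1 : Ω → ℝ) x) ∂μ =
        l / 2 * (∑ j ∈ I, ∑ k ∈ I, μ.real (F j ∩ F k)) + 1 / (2 * l) * μ.real (G M) := by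
      rw [integral_add (hi2.const_mul (l/2)) ((hIntegr _ (hGm M)).const_mul (1/(2*l))),
        integral_const_mul, integral_const_mul, v2, integral_indicator_one (hGm M)]
    have hle' : S ≤ l / 2 * (∑ j ∈ I, ∑ k ∈ I, μ.real (F j ∩ F k)) + 1 / (2 * l) * μ.real (G M) := by
      rw [← v1, ← v3]; exact hle
    have h5 : l / 2 * (∑ j ∈ I, ∑ k ∈ I, μ.real (F j ∩ F k)) ≤ l / 2 * (2 * K * S * S) := by
      gcongr
      refine hsum2.trans ?_
      have : 4 * S ≤ S * S := by nlinarith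
      nlinarith
    have h6 : l / 2 * (2 * K * S * S) = S / 2 := by rw [hl]; field_simp
    have h7 : 1 / (2 * l) = K * S := by rw [hl]; field_simp
    rw [h7] at hle'
    rw [div_le_iff₀ (by positivity)]
    have h8 : S * 1 ≤ S * (μ.real (G M) * (2 * K)) := by linarith
    exact le_of_mul_le_mul_left h8 hSpos
  have hset : {x | ∃ᶠ k in atTop, x ∈ F k} = ⋂ M, G M := by
    ext x
    simp only [G, Set.mem_ofPred_eq, frequently_atTop, Set.mem_iInter, Set.mem_iUnion, exists_prop]
  rw [hset]
  have hanti : Antitone G := fun M M' h =>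
    Set.iUnion₂_subset fun k hk => Set.subset_iUnion₂_of_subset k (le_trans h hk) subset_rfl
  have ht := tendsto_measure_iInter_atTop (μ := μ) (fun M => (hGm M).nullMeasurableSet) hanti
    ⟨0, measure_ne_top _ _⟩
  have hge : ENNReal.ofReal (1 / (2 * K)) ≤ μ (⋂ M, G M) := by
    refine ge_of_tendsto' ht fun M => ?_
    exact (ENNReal.ofReal_le_iff_le_toReal (measure_ne_top μ (G M))).mpr (hG M)
  exact lt_of_lt_of_le (ENNReal.ofReal_pos.mpr (by positivity)) hge

lemma mtor_sep {d : ℕ} (a : MTor d) (C : ℝ) (hC : 0 < C)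
    (h : ∀ Q : ℤ, Q ≠ 0 → C * |(Q:ℝ)| ^ (-(1:ℝ)/(d:ℝ)) ≤ ‖Q • a‖) (x : MTor d) (s L : ℕ) :
    ∀ m ∈ Finset.Ico s (s + L), ∀ n ∈ Finset.Ico s (s + L), m ≠ n →
      C * (L:ℝ) ^ (-(1:ℝ)/(d:ℝ)) ≤ dist (x - m • a) (x - n • a) := by
  intro m hm n hn hmn
  rw [Finset.mem_Ico] at hm hn
  have hne : ((n:ℤ) - m) ≠ 0 := by omega
  have e : dist (x - m • a) (x - n • a) = ‖((n:ℤ) - m) • a‖ := by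
    rw [dist_eq_norm, sub_smul, natCast_zsmul, natCast_zsmul]
    congr 1; abel
  rw [e]
  refine le_trans ?_ (h _ hne)
  have h1 : |((n:ℤ) - m)| ≤ L := by rw [abs_le]; omega
  have h2 : |((((n:ℤ) - m : ℤ)) : ℝ)| ≤ L := by exact_mod_cast h1
  have h3 : 0 < |((((n:ℤ) - m : ℤ)) : ℝ)| := abs_pos.mpr (by exact_mod_cast hne)
  refine mul_le_mul_of_nonneg_left ?_ hC.le
  apply Real.rpow_le_rpow_of_nonpos h3 h2
  apply div_nonpos_of_nonpos_of_nonneg <;> [norm_num; positivity]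

lemma mtor_C_le {d : ℕ} (a : MTor d) (C : ℝ)
    (h : ∀ Q : ℤ, Q ≠ 0 → C * |(Q:ℝ)| ^ (-(1:ℝ)/(d:ℝ)) ≤ ‖Q • a‖) : C ≤ 1 / 2 := by
  have h1 := h 1 one_ne_zero
  simp only [Int.cast_one, abs_one, Real.one_rpow, mul_one, one_smul] at h1
  refine h1.trans ((pi_norm_le_iff_of_nonneg (by norm_num)).mpr fun i => ?_)
  simpa using AddCircle.norm_le_half_period (1:ℝ) one_ne_zero (x := a i)

open scoped Pointwise in
lemma mtor_dense {d : ℕ} (hd : 0 < d) (a : MTor d) (C : ℝ) (hC : 0 < C)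
    (h : ∀ Q : ℤ, Q ≠ 0 → C * |(Q:ℝ)| ^ (-(1:ℝ)/(d:ℝ)) ≤ ‖Q • a‖) :
    DenseRange (fun n : ℤ => n • a) := by
  have hC2 := mtor_C_le a C h
  set H := (AddSubgroup.zmultiples a).topologicalClosure with hH
  have hHc : IsClosed (H : Set (MTor d)) := AddSubgroup.isClosed_topologicalClosure _
  have hpos : 0 < volume (H : Set (MTor d)) := by
    have ht := tendsto_measure_thickening_of_isClosed (μ := (volume : Measure (MTor d)))
      (s := (H : Set (MTor d))) ⟨1, one_pos, measure_ne_top _ _⟩ hHc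
    refine lt_of_lt_of_le (ENNReal.ofReal_pos.mpr (by positivity : 0 < C ^ d)) ?_
    refine ge_of_tendsto ht ?_
    filter_upwards [self_mem_nhdsWithin] with r hr
    have hr : 0 < r := hr
    have hlim : Tendsto (fun L : ℕ => C * (L:ℝ) ^ (-(1:ℝ)/(d:ℝ))) atTop (𝓝 0) := by
      have h1 : Tendsto (fun x : ℝ => x ^ (-(1/(d:ℝ)))) atTop (𝓝 0) :=
        tendsto_rpow_neg_atTop (by positivity)
      have := (h1.comp tendsto_natCast_atTop_atTop).const_mul C
      simpa [neg_div, Function.comp_def] using this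
    obtain ⟨L, hL, hL0⟩ := ((hlim.eventually_lt_const hr).and (eventually_gt_atTop 0)).exists
    have hLr : (1:ℝ) ≤ L := by exact_mod_cast hL0
    set δ := C * (L:ℝ) ^ (-(1:ℝ)/(d:ℝ)) with hδ
    have hδ0 : 0 < δ := by positivity
    have hδ1 : δ ≤ 1 := by
      have := Real.rpow_le_one_of_one_le_of_nonpos hLr
        (div_nonpos_of_nonpos_of_nonneg (by norm_num) (by positivity) : (-(1:ℝ)/(d:ℝ)) ≤ 0)
      nlinarith
    have hu := mtor_union hd (Finset.Ico 0 (0 + L)) (fun n => 0 - n • a) δ (δ/2) hδ1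
      (mtor_sep a C hC h 0 0 L) (by positivity) le_rfl
    rw [mul_div_cancel₀ δ two_ne_zero, hδ, mul_pow, mtor_pow_rpow hd (by positivity)] at hu
    have hu' : volume.real (⋃ n ∈ Finset.Ico 0 (0 + L), ball ((0 : MTor d) - n • a) (δ/2)) = C ^ d := by
      rw [hδ, hu]
      simp
      field_simp
    rw [← hu', measureReal_def, ENNReal.ofReal_toReal (measure_ne_top _ _)]
    apply measure_mono
    refine Set.iUnion₂_subset fun n _ => ?_
    intro x hx
    rw [mem_thickening_iff]
    refine ⟨0 - n • a, ?_, ?_⟩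
    · apply AddSubgroup.le_topologicalClosure
      exact AddSubgroup.sub_mem _ (AddSubgroup.zero_mem _)
        (AddSubgroup.nsmul_mem _ (AddSubgroup.mem_zmultiples a) n)
    · rw [mem_ball] at hx; linarith
  have hn := Measure.sub_mem_nhds_zero_of_addHaar_pos volume (H : Set (MTor d))
    hHc.measurableSet hpos
  have hsub : (H : Set (MTor d)) - (H : Set (MTor d)) ⊆ H := by
    rintro _ ⟨x, hx, y, hy, rfl⟩
    exact H.sub_mem hx hy
  have hopen : IsOpen (H : Set (MTor d)) := AddSubgroup.isOpen_of_mem_nhds H (mem_of_superset hn hsub)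
  have huniv : (H : Set (MTor d)) = Set.univ :=
    IsClopen.eq_univ ⟨hHc, hopen⟩ ⟨0, H.zero_mem⟩
  rw [DenseRange, dense_iff_closure_eq, ← huniv, hH, AddSubgroup.topologicalClosure_coe]
  rfl

lemma mtor_condense (a : ℕ → ℝ) (ha : Antitone a) (h0 : ∀ n, 0 ≤ a n) (c : ℝ) (hc : 0 < c)
    (hs : ¬ Summable a) : ¬ Summable (fun k : ℕ => min ((2:ℝ) ^ k * a (2 ^ (k+1))) c) := by
  intro h
  apply hs
  rw [← summable_condensed_iff_of_nonneg h0 (fun m n _ h => ha h), ← summable_nat_add_iff 1]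
  have h1 : Summable (fun k : ℕ => (2:ℝ) ^ k * a (2 ^ (k+1))) := by
    refine h.congr_atTop ?_
    filter_upwards [h.tendsto_atTop_zero.eventually_lt_const hc] with k hk
    exact min_eq_left (by
      rcases min_lt_iff.mp hk with h | h
      · exact h.le
      · exact absurd h (lt_irrefl _))
  refine (h1.mul_left 2).congr fun k => ?_
  rw [pow_succ (2:ℝ)]; ring

lemma mtor_backward {d : ℕ} (hd : 0 < d) (a : MTor d) (C : ℝ) (hC : 0 < C)
    (h : ∀ Q : ℤ, Q ≠ 0 → C * |(Q:ℝ)| ^ (-(1:ℝ)/(d:ℝ)) ≤ ‖Q • a‖) (x₀ : MTor d) (r : ℕ → ℝ)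
    (hr : Antitone r) (hr0 : ∀ n, 0 ≤ r n) (hs : ∑' n, volume (ball x₀ (r n)) = ⊤) :
    volume {x : MTor d | ∃ᶠ n in atTop, x + n • a ∈ ball x₀ (r n)} = 1 := by
  have hC2 := mtor_C_le a C h
  set L := {x : MTor d | ∃ᶠ n in atTop, x + n • a ∈ ball x₀ (r n)} with hL
  have hLm : MeasurableSet L := by
    have e : L = ⋂ M : ℕ, ⋃ n ≥ M, {x : MTor d | x + n • a ∈ ball x₀ (r n)} := by
      ext x
      simp only [hL, Set.mem_ofPred_eq, frequently_atTop, Set.mem_iInter, Set.mem_iUnion, exists_prop]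
    rw [e]
    refine MeasurableSet.iInter fun M => MeasurableSet.iUnion fun n => MeasurableSet.iUnion fun _ => ?_
    exact (isOpen_ball.preimage (continuous_id.add continuous_const)).measurableSet
  -- positive measure
  have hLpos : 0 < volume L := by
    let δ : ℕ → ℝ := fun k => C * ((2 ^ k : ℕ) : ℝ) ^ (-(1:ℝ)/(d:ℝ))
    have hδ0 : ∀ k, 0 < δ k := fun k => by simp only [δ]; positivity
    have hδd : ∀ k, δ k ^ d = C ^ d / 2 ^ k := fun k => by
      simp only [δ]
      rw [mul_pow, mtor_pow_rpow hd (by positivity)]; push_cast; rfl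
    have hδ1 : ∀ k, δ k ≤ 1 := fun k => by
      have h1 : (1:ℝ) ≤ ((2 ^ k : ℕ) : ℝ) := by exact_mod_cast Nat.one_le_two_pow
      have := Real.rpow_le_one_of_one_le_of_nonpos h1
        (div_nonpos_of_nonpos_of_nonneg (by norm_num) (by positivity) : (-(1:ℝ)/(d:ℝ)) ≤ 0)
      simp only [δ]
      nlinarith
    let ρ : ℕ → ℝ := fun k => min (r (2 ^ (k+1))) (δ k / 2)
    have hρ0 : ∀ k, 0 ≤ ρ k := fun k => le_min (hr0 _) (by have := hδ0 k; positivity)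
    have hρδ : ∀ k, ρ k ≤ δ k / 2 := fun k => min_le_right _ _
    let c : ℕ → MTor d := fun n => x₀ - n • a
    let S : ℕ → Finset ℕ := fun k => Finset.Ico (2 ^ k) (2 ^ k + 2 ^ k)
    have hScard : ∀ k, ((S k).card : ℝ) = 2 ^ k := fun k => by simp [S]
    let F : ℕ → Set (MTor d) := fun k => ⋃ n ∈ S k, ball (c n) (ρ k)
    have hsep : ∀ k, ∀ m ∈ S k, ∀ n ∈ S k, m ≠ n → δ k ≤ dist (c m) (c n) :=
      fun k => mtor_sep a C hC h x₀ (2 ^ k) (2 ^ k)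
    have hFm : ∀ k, MeasurableSet (F k) := fun k =>
      MeasurableSet.iUnion fun n => MeasurableSet.iUnion fun _ => measurableSet_ball
    have hFv : ∀ k, volume.real (F k) = 2 ^ k * (2 * ρ k) ^ d := fun k => by
      rw [← hScard]
      exact mtor_union hd (S k) c (δ k) (ρ k) (hδ1 k) (hsep k) (hρ0 k) (hρδ k)
    have hks := kochen_stone (volume : Measure (MTor d)) F hFm ((2 / C) ^ d) (by positivity) ?_ ?_
    · refine lt_of_lt_of_le hks (measure_mono ?_)
      intro x hx
      have hx : ∃ᶠ k in atTop, x ∈ F k := hx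
      show ∃ᶠ n in atTop, x + n • a ∈ ball x₀ (r n)
      rw [frequently_atTop] at hx ⊢
      intro M
      obtain ⟨k, hk, hxk⟩ := hx M
      obtain ⟨n, hn, hxn⟩ := Set.mem_iUnion₂.mp hxk
      have hn' := Finset.mem_Ico.mp hn
      refine ⟨n, ?_, ?_⟩
      · have := Nat.lt_two_pow_self (n := k)
        omega
      · rw [mem_ball, dist_eq_norm] at hxn ⊢
        have e : x + n • a - x₀ = x - c n := by simp only [c]; abel
        rw [e]
        refine hxn.trans_le ((min_le_left _ _).trans (hr ?_))
        rw [pow_succ]; omega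
    · intro j k _
      refine (mtor_inter hd (S j) (S k) c (δ k) (ρ j) (ρ k) (hδ0 k) (hδ1 k) (hsep k) (hρ0 j)
        (hρ0 k) (hρδ k)).trans ?_
      rw [hFv, hFv, hScard, mul_pow 2 (δ k), hδd, div_pow]
      set p := (2 * ρ j) ^ d
      set q := (2 * ρ k) ^ d
      have hp : 0 ≤ p := pow_nonneg (by have := hρ0 j; positivity) _
      have hq : 0 ≤ q := pow_nonneg (by have := hρ0 k; positivity) _
      have hCd : (2:ℝ) ^ d * C ^ d ≤ 1 := by
        rw [← mul_pow]; exact pow_le_one₀ (by positivity) (by linarith)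
      have hCpos : 0 < C ^ d := by positivity
      have e1 : (2:ℝ) ^ j * (2 ^ d * (p + 2 ^ d * (C ^ d / 2 ^ k)) / (C ^ d / 2 ^ k) * q) =
          2 ^ d / C ^ d * (2 ^ j * p * (2 ^ k * q) + 2 ^ j * q * (2 ^ d * C ^ d)) := by
        field_simp
      have e2 : (2:ℝ) ^ j / 2 ^ k * (2 ^ k * q) = 2 ^ j * q * 1 := by
        field_simp
      rw [e1, e2]
      gcongr
    · have hns : ¬ Summable (fun n => (2 * r n) ^ d) := by
        intro hsum
        have h1 : ∑' n, volume (ball x₀ (r n)) ≤ ∑' n, ENNReal.ofReal ((2 * r n) ^ d) :=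
          ENNReal.tsum_le_tsum fun n => mtor_ball_le hd x₀ (hr0 n)
        rw [hs, ← ENNReal.ofReal_tsum_of_nonneg
          (fun n => pow_nonneg (by have := hr0 n; positivity) _) hsum] at h1
        exact ENNReal.ofReal_ne_top (top_le_iff.mp h1)
      have hc := mtor_condense (fun n => (2 * r n) ^ d) (fun m n hmn => by
        have := hr hmn
        have := hr0 n
        show (2 * r n) ^ d ≤ (2 * r m) ^ d
        gcongr) (fun n => pow_nonneg (by have := hr0 n; positivity) _) (C ^ d) (by positivity) hns
      convert hc using 3 with k
      rw [hFv]
      have hδk := hδ0 k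
      have hrk := hr0 (2 ^ (k+1))
      have e3 : (2:ℝ) ^ k * δ k ^ d = C ^ d := by rw [hδd]; field_simp
      rcases le_total (r (2 ^ (k+1))) (δ k / 2) with hle | hle
      · have : ρ k = r (2 ^ (k+1)) := min_eq_left hle
        rw [this, min_eq_left]
        rw [← e3]
        gcongr
        linarith
      · have : ρ k = δ k / 2 := min_eq_right hle
        rw [this, mul_div_cancel₀ _ two_ne_zero, e3, min_eq_right]
        rw [← e3]
        gcongr
        linarith
  -- ergodicity
  have herg := ergodic_add_left_of_denseRange_zsmul (mtor_dense hd a C hC h)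
    (volume : Measure (MTor d))
  have hinv : L ⊆ (fun x => a + x) ⁻¹' L := by
    intro x hx
    have hx : ∃ᶠ n in atTop, x + n • a ∈ ball x₀ (r n) := hx
    show ∃ᶠ n in atTop, (a + x) + n • a ∈ ball x₀ (r n)
    rw [frequently_atTop] at hx ⊢
    intro M
    obtain ⟨n, hn, hxn⟩ := hx (M + 1)
    obtain ⟨m, rfl⟩ : ∃ m, n = m + 1 := ⟨n - 1, by omega⟩
    refine ⟨m, by omega, ?_⟩
    have e : (a + x) + m • a = x + (m + 1) • a := by rw [succ_nsmul]; abel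
    rw [e]
    exact ball_subset_ball (hr (Nat.le_succ m)) hxn
  rcases herg.ae_empty_or_univ_of_ae_le_preimage hLm.nullMeasurableSet
    (LE.le.eventuallyLE hinv) with h1 | h1
  · rw [measure_congr h1, measure_empty] at hLpos
    exact absurd hLpos (lt_irrefl _)
  · rw [measure_congr h1, mtor_univ]

/-- A toral translation has the MSTP iff its vector is of constant type. -/
theorem stmt8 (d : ℕ) (hd : 0 < d) (α : Fin d → ℝ) :
    (∀ x₀ : Fin d → AddCircle (1:ℝ), ∀ r : ℕ → ℝ, Antitone r → (∀ n, 0 ≤ r n) →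
        (∑' n, volume (ball x₀ (r n)) = ⊤) →
        volume {x : Fin d → AddCircle (1:ℝ) | ∃ᶠ n in atTop,
          (fun y => y + fun i => ((α i : ℝ) : AddCircle (1:ℝ)))^[n] x ∈ ball x₀ (r n)} = 1)
    ↔ ∃ C : ℝ, 0 < C ∧ ∀ Q : ℤ, Q ≠ 0 →
        C * |(Q : ℝ)| ^ (-(1:ℝ)/(d:ℝ)) ≤ normZ (fun i => (Q : ℝ) * α i) := by
  set a : MTor d := fun i => ((α i : ℝ) : AddCircle (1:ℝ)) with ha
  have hn : ∀ Q : ℤ, normZ (fun i => (Q : ℝ) * α i) = ‖Q • a‖ := by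
    intro Q
    rw [normZ, dist_zero_right]
    congr 1
    funext i
    rw [← zsmul_eq_mul, AddCircle.coe_zsmul]
    rfl
  have hit : ∀ (n : ℕ) (x : MTor d), (fun y => y + a)^[n] x = x + n • a := by
    intro n x
    rw [add_right_iterate]
  simp only [hn, hit]
  constructor
  · intro hM
    by_contra hcon
    push Not at hcon
    obtain ⟨r, h1, h2, h3, h4⟩ := mtor_forward hd a hcon
    exact h4.ne (hM 0 r h1 h2 h3)
  · rintro ⟨C, hC, h⟩ x₀ r h1 h2 h3
    exact mtor_backward hd a C hC h x₀ r h1 h2 h3
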